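/- Let n = (q^m−1)/(q−1) ≥ 6 and let t_1 and t_2 be any two distinct coordinate positions of the Hamming code H_{(q,m)}. Then the shortened code (H_{(q,m)})_{{t_1,t_2}} is an [n−2, n−m−2, 3] code over GF(q), and its weight distribution satisfies A_k((H_{(q,m)})_{{t_1,t_2}}) = (C(k,2)·C(n−2,k) / (C(n,2)·C(n−2,k−2)))·A_k(H_{(q,m)}) for all 0 ≤ k ≤ n−2, where C(a,b) denotes the binomial coefficient. -/

import Mathlib

open Finset

section Defs

variable {F : Type} [Field F]

/-- The dual of a linear code `C ⊆ F^ι` w.r.t. the standard inner product. -/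
def dualCode {ι : Type} [Fintype ι] (C : Submodule F (ι → F)) :
    Submodule F (ι → F) where
  carrier := {x | ∀ c ∈ C, ∑ i, x i * c i = 0}
  add_mem' := by
    intro a b ha hb c hc
    simp only [Set.mem_setOf_eq] at ha hb ⊢
    simp only [Pi.add_apply, add_mul, Finset.sum_add_distrib, ha c hc, hb c hc, add_zero]
  zero_mem' := by
    intro c hc
    simp
  smul_mem' := by
    intro r a ha c hc
    simp only [Set.mem_setOf_eq] at ha ⊢
    simp only [Pi.smul_apply, smul_eq_mul, mul_assoc, ← Finset.mul_sum, ha c hc, mul_zero]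

/-- The subcode of codewords vanishing on every coordinate in `T`. -/
def zeroOn {ι : Type} (T : Finset ι) : Submodule F (ι → F) where
  carrier := {x | ∀ i ∈ T, x i = 0}
  add_mem' := by
    intro a b ha hb i hi
    simp only [Set.mem_setOf_eq] at ha hb
    simp [Pi.add_apply, ha i hi, hb i hi]
  zero_mem' := by intro i _; simp
  smul_mem' := by
    intro r a ha i hi
    simp only [Set.mem_setOf_eq] at ha
    simp [Pi.smul_apply, ha i hi]

/-- Deleting the coordinates in `T`. -/
def restrictTo {ι : Type} (T : Finset ι) : (ι → F) →ₗ[F] ({i : ι // i ∉ T} → F) :=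
  LinearMap.funLeft F F Subtype.val

/-- The punctured code `C^T`: delete the coordinates in `T` from every codeword. -/
def puncturedCode {ι : Type} (C : Submodule F (ι → F)) (T : Finset ι) :
    Submodule F ({i : ι // i ∉ T} → F) :=
  C.map (restrictTo T)

/-- The shortened code `C_T`: take the codewords vanishing on `T`, then delete `T`. -/
def shortenedCode {ι : Type} (C : Submodule F (ι → F)) (T : Finset ι) :
    Submodule F ({i : ι // i ∉ T} → F) :=
  (C ⊓ zeroOn T).map (restrictTo T)

/-- The code `C` has minimum distance (exactly) `d`. -/
def IsMinDist {ι : Type} [Fintype ι] [DecidableEq F] (C : Submodule F (ι → F)) (d : ℕ) : Prop :=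
  (∃ c ∈ C, c ≠ 0 ∧ hammingNorm c = d) ∧ ∀ c ∈ C, c ≠ 0 → d ≤ hammingNorm c

/-- `A_k(C)`: the number of codewords of Hamming weight `k` in `C`. -/
noncomputable def weightCount {ι : Type} [Fintype ι] [DecidableEq F]
    (C : Submodule F (ι → F)) (k : ℕ) : ℕ :=
  Nat.card {c : ι → F // c ∈ C ∧ hammingNorm c = k}

/-- A monomial transformation: permute the coordinates and scale each coordinate. -/
def monomialMap {ι κ : Type} (σ : ι ≃ κ) (u : κ → F) : (ι → F) →ₗ[F] (κ → F) where
  toFun x := fun j => u j * x (σ.symm j)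
  map_add' a b := by
    funext j
    simp [Pi.add_apply, mul_add]
  map_smul' r a := by
    funext j
    simp only [Pi.smul_apply, smul_eq_mul, RingHom.id_apply]
    ring

/-- Monomial equivalence of linear codes. -/
def MonomiallyEquiv {ι κ : Type} (C : Submodule F (ι → F)) (D : Submodule F (κ → F)) : Prop :=
  ∃ (σ : ι ≃ κ) (u : κ → F), (∀ j, u j ≠ 0) ∧ D = C.map (monomialMap σ u)

/-- The syndrome map attached to a parity-check matrix with columns `v i`. -/
def checkMap {m n : ℕ} (v : Fin n → (Fin m → F)) : (Fin n → F) →ₗ[F] (Fin m → F) where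
  toFun x := fun j => ∑ i, x i * v i j
  map_add' a b := by
    funext j
    simp [Pi.add_apply, add_mul, Finset.sum_add_distrib]
  map_smul' r a := by
    funext j
    simp [Pi.smul_apply, Finset.mul_sum, mul_assoc]

/-- `v` lists exactly one nonzero vector from each one-dimensional subspace of `F^m`. -/
def IsHammingMatrix {m n : ℕ} (v : Fin n → (Fin m → F)) : Prop :=
  (∀ i, v i ≠ 0) ∧ ∀ w : Fin m → F, w ≠ 0 → ∃! i : Fin n, ∃ c : F, w = c • v i

/-- The Hamming code attached to a parity-check matrix whose columns are the `v i`. -/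
def hammingCode {m n : ℕ} (v : Fin n → (Fin m → F)) : Submodule F (Fin n → F) :=
  LinearMap.ker (checkMap v)

/-- The Simplex code: the dual of the Hamming code. -/
def simplexCode {m n : ℕ} (v : Fin n → (Fin m → F)) : Submodule F (Fin n → F) :=
  dualCode (hammingCode v)

end Defs

section Helpers

variable {F : Type} [Field F] {m n : ℕ}

lemma ham_ne {v : Fin n → (Fin m → F)} (hv : IsHammingMatrix v) {i j : Fin n} (hij : i ≠ j)
    (c : F) : v i ≠ c • v j := by
  intro h
  obtain ⟨k, -, hk⟩ := hv.2 (v i) (hv.1 i)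
  exact hij ((hk i ⟨1, by simp⟩).trans (hk j ⟨c, h⟩).symm)

lemma checkMap_eq (v : Fin n → (Fin m → F)) (x : Fin n → F) :
    checkMap v x = ∑ i, x i • v i := by
  funext j
  simp [checkMap]

lemma ham_pair {v : Fin n → (Fin m → F)} (hv : IsHammingMatrix v) {i j : Fin n} (hij : i ≠ j)
    {a b : F} (h : a • v i + b • v j = 0) : a = 0 ∧ b = 0 := by
  have ha : a = 0 := by
    by_contra ha
    apply ham_ne hv hij (-(a⁻¹ * b))
    have := congrArg (fun z => a⁻¹ • z) h
    simp only [smul_add, smul_smul, inv_mul_cancel₀ ha, one_smul, smul_zero] at this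
    rw [neg_smul]
    exact eq_neg_of_add_eq_zero_left this
  refine ⟨ha, ?_⟩
  subst ha
  simpa [hv.1 j] using h

open scoped LinearAlgebra.Projectivization in
lemma ham_trans {v : Fin n → (Fin m → F)} (hv : IsHammingMatrix v) {s1 s2 t1 t2 : Fin n}
    (hs : s1 ≠ s2) (ht : t1 ≠ t2) :
    ∃ (e : Fin n ≃ Fin n) (c : Fin n → F) (g : (Fin m → F) ≃ₗ[F] (Fin m → F)),
      (∀ i, c i ≠ 0) ∧ (∀ i, g (v i) = c i • v (e i)) ∧ e s1 = t1 ∧ e s2 = t2 := by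
  have key : ∀ i j : Fin n, i ≠ j → Projectivization.mk F (v i) (hv.1 i) ≠
      Projectivization.mk F (v j) (hv.1 j) := by
    intro i j hij h
    rw [Projectivization.mk_eq_mk_iff'] at h
    obtain ⟨a, ha⟩ := h
    exact ham_ne hv hij a ha.symm
  obtain ⟨g, hg1, hg2⟩ := MulAction.is_two_pretransitive_iff.1
    (Projectivization.linearEquiv_is_two_pretransitive F (Fin m → F)) (key _ _ hs) (key _ _ ht)
  rw [Projectivization.smul_mk, Projectivization.mk_eq_mk_iff'] at hg1 hg2
  obtain ⟨a1, ha1⟩ := hg1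
  obtain ⟨a2, ha2⟩ := hg2
  have gne : ∀ i, g (v i) ≠ 0 := fun i => by simpa using hv.1 i
  have hex : ∀ i, ∃ j, ∃ c : F, g (v i) = c • v j := fun i => (hv.2 _ (gne i)).exists
  choose σ c hc using hex
  have cne : ∀ i, c i ≠ 0 := by
    intro i h
    apply gne i
    rw [hc, h, zero_smul]
  have huniq : ∀ i j, (∃ b : F, g (v i) = b • v j) → σ i = j := by
    intro i j hb
    obtain ⟨k, -, hk⟩ := hv.2 _ (gne i)
    exact (hk _ ⟨_, hc i⟩).trans (hk _ hb).symm
  have inj : Function.Injective σ := by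
    intro i j hij
    by_contra hne
    apply ham_ne hv hne (c i * (c j)⁻¹)
    apply g.injective
    rw [map_smul, hc, hc, hij, smul_smul, mul_assoc, inv_mul_cancel₀ (cne j), mul_one]
  refine ⟨Equiv.ofBijective σ (Finite.injective_iff_bijective.1 inj), c, g, cne, hc, ?_, ?_⟩
  · exact huniq _ _ ⟨a1, ha1.symm⟩
  · exact huniq _ _ ⟨a2, ha2.symm⟩

variable [Fintype F] [DecidableEq F]

/-- words of weight k vanishing on s1, s2 -/
def words (v : Fin n → (Fin m → F)) (k : ℕ) : Finset (Fin n → F) :=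
  Finset.univ.filter fun x => checkMap v x = 0 ∧ hammingNorm x = k

lemma words_le {v : Fin n → (Fin m → F)} (hv : IsHammingMatrix v) {s1 s2 t1 t2 : Fin n}
    (hs : s1 ≠ s2) (ht : t1 ≠ t2) (k : ℕ) :
    ((words v k).filter fun x => x s1 = 0 ∧ x s2 = 0).card ≤
    ((words v k).filter fun x => x t1 = 0 ∧ x t2 = 0).card := by
  obtain ⟨e, c, g, hc, hg, rfl, rfl⟩ := ham_trans hv hs ht
  apply Finset.card_le_card_of_injOn (fun x j => c (e.symm j) * x (e.symm j))
  · intro x hx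
    simp only [words, Finset.coe_filter, Finset.mem_filter, Finset.mem_univ, true_and,
      Set.mem_setOf_eq] at hx ⊢
    obtain ⟨⟨h1, h2⟩, h3, h4⟩ := hx
    refine ⟨⟨?_, ?_⟩, by simp [h3], by simp [h4]⟩
    · rw [checkMap_eq] at h1 ⊢
      rw [← Equiv.sum_comp e]
      have := congrArg g h1
      simp only [map_sum, map_smul, hg, map_zero, smul_smul] at this
      simpa [mul_comm] using this
    · rw [← h2]
      unfold hammingNorm
      apply Finset.card_bij' (fun j _ => e.symm j) (fun j _ => e j) <;> simp [hc]
  · intro x _ y _ h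
    funext i
    have := congrFun h (e i)
    simpa [hc] using this

lemma words_eq {v : Fin n → (Fin m → F)} (hv : IsHammingMatrix v) {s1 s2 t1 t2 : Fin n}
    (hs : s1 ≠ s2) (ht : t1 ≠ t2) (k : ℕ) :
    ((words v k).filter fun x => x s1 = 0 ∧ x s2 = 0).card =
    ((words v k).filter fun x => x t1 = 0 ∧ x t2 = 0).card :=
  le_antisymm (words_le hv hs ht k) (words_le hv ht hs k)

lemma count_zero {k : ℕ} (x : Fin n → F) (hx : hammingNorm x = k) :
    ((Finset.univ : Finset (Fin n)).offDiag.filter fun p => x p.1 = 0 ∧ x p.2 = 0).card =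
      (n - k) * (n - k) - (n - k) := by
  have h : ((Finset.univ : Finset (Fin n)).filter fun i => x i = 0).card = n - k := by
    have := Finset.card_filter_add_card_filter_not (s := (Finset.univ : Finset (Fin n)))
      (fun i => x i = 0)
    simp only [Finset.card_univ, Fintype.card_fin] at this
    unfold hammingNorm at hx
    simp only [ne_eq] at hx
    omega
  rw [← h, ← Finset.offDiag_card]
  congr 1
  ext p
  simp only [Finset.mem_filter, Finset.mem_offDiag, Finset.mem_univ, true_and]
  tauto

lemma double_count {v : Fin n → (Fin m → F)} (hv : IsHammingMatrix v) {t1 t2 : Fin n}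
    (ht : t1 ≠ t2) (k : ℕ) :
    (n * n - n) * ((words v k).filter fun x => x t1 = 0 ∧ x t2 = 0).card =
    (words v k).card * ((n - k) * (n - k) - (n - k)) := by
  have := Finset.sum_card_bipartiteAbove_eq_sum_card_bipartiteBelow
    (s := (Finset.univ : Finset (Fin n)).offDiag) (t := words v k)
    (fun p x => x p.1 = 0 ∧ x p.2 = 0)
  unfold Finset.bipartiteAbove Finset.bipartiteBelow at this
  rw [Finset.sum_congr rfl (g := fun _ =>
      ((words v k).filter fun x => x t1 = 0 ∧ x t2 = 0).card),
    Finset.sum_congr (s₁ := words v k) rfl (g := fun _ => (n - k) * (n - k) - (n - k))] at this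
  · simpa [Finset.offDiag_card] using this
  · intro x hx
    exact count_zero x (by simpa [words] using (Finset.mem_filter.1 hx).2.2)
  · intro p hp
    exact words_eq hv (by simpa using hp) ht k

lemma weightCount_ham (v : Fin n → (Fin m → F)) (k : ℕ) :
    weightCount (hammingCode v) k = (words v k).card := by
  unfold weightCount words
  classical
  rw [Nat.card_eq_fintype_card, Fintype.card_subtype]
  congr 1
  ext x
  simp only [Finset.mem_filter, Finset.mem_univ, true_and]
  rfl

lemma norm_restrict (T : Finset (Fin n)) (x : Fin n → F) (hx : ∀ i ∈ T, x i = 0) :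
    hammingNorm (restrictTo T x) = hammingNorm x := by
  unfold hammingNorm
  apply Finset.card_bij (fun i _ => i.1)
  · intro i hi
    exact Finset.mem_filter.2 ⟨Finset.mem_univ _, (Finset.mem_filter.1 hi).2⟩
  · intro i _ j _ h
    exact Subtype.ext h
  · intro i hi
    simp only [Finset.mem_filter, Finset.mem_univ, true_and] at hi
    exact ⟨⟨i, fun h => hi (hx i h)⟩, Finset.mem_filter.2 ⟨Finset.mem_univ _, hi⟩, rfl⟩

lemma restrict_inj (T : Finset (Fin n)) (x y : Fin n → F) (hx : ∀ i ∈ T, x i = 0)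
    (hy : ∀ i ∈ T, y i = 0) (h : restrictTo T x = restrictTo T y) : x = y := by
  funext i
  by_cases hi : i ∈ T
  · rw [hx i hi, hy i hi]
  · exact congrFun h ⟨i, hi⟩

lemma weightCount_short (v : Fin n → (Fin m → F)) (t1 t2 : Fin n) (k : ℕ) :
    weightCount (shortenedCode (hammingCode v) {t1, t2}) k =
      ((words v k).filter fun x => x t1 = 0 ∧ x t2 = 0).card := by
  unfold weightCount
  classical
  rw [Nat.card_eq_fintype_card, Fintype.card_subtype]
  symm
  apply Finset.card_bij (fun x _ => restrictTo {t1, t2} x)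
  · intro x hx
    simp only [words, Finset.mem_filter, Finset.mem_univ, true_and] at hx ⊢
    have h0 : ∀ i ∈ ({t1, t2} : Finset (Fin n)), x i = 0 := by simpa using hx.2
    exact ⟨⟨x, ⟨hx.1.1, h0⟩, rfl⟩, by rw [norm_restrict _ _ h0, hx.1.2]⟩
  · intro x hx y hy h
    refine restrict_inj _ _ _ ?_ ?_ h
    · simpa using (Finset.mem_filter.1 hx).2
    · simpa using (Finset.mem_filter.1 hy).2
  · intro y hy
    obtain ⟨⟨x, ⟨h1, h0⟩, rfl⟩, h2⟩ := (Finset.mem_filter.1 hy).2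
    rw [norm_restrict _ _ h0] at h2
    refine ⟨x, ?_, rfl⟩
    simp only [words, Finset.mem_filter, Finset.mem_univ, true_and]
    exact ⟨⟨h1, h2⟩, by simpa using (show ∀ i ∈ ({t1, t2} : Finset (Fin n)), x i = 0 from h0)⟩

lemma ham_min {v : Fin n → (Fin m → F)} (hv : IsHammingMatrix v) (x : Fin n → F)
    (hx : checkMap v x = 0) (h0 : x ≠ 0) : 3 ≤ hammingNorm x := by
  by_contra hlt
  have hpos := hammingNorm_pos_iff.2 h0
  rw [checkMap_eq] at hx
  have hs : ∑ i ∈ Finset.univ.filter (fun i => x i ≠ 0), x i • v i = 0 := by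
    rw [← hx]
    apply Finset.sum_subset (Finset.subset_univ _)
    intro i _ hi
    have : x i = 0 := by simpa using hi
    rw [this, zero_smul]
  obtain h | h : hammingNorm x = 1 ∨ hammingNorm x = 2 := by omega
  · obtain ⟨i, hi⟩ := Finset.card_eq_one.1 h
    have hxi : i ∈ Finset.univ.filter (fun i => x i ≠ 0) := by rw [hi]; simp
    rw [hi, Finset.sum_singleton, smul_eq_zero] at hs
    rcases hs with hs | hs
    · exact (Finset.mem_filter.1 hxi).2 hs
    · exact hv.1 i hs
  · obtain ⟨i, j, hij, hi⟩ := Finset.card_eq_two.1 h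
    have hxi : i ∈ Finset.univ.filter (fun i => x i ≠ 0) := by rw [hi]; simp
    rw [hi, Finset.sum_pair hij] at hs
    exact (Finset.mem_filter.1 hxi).2 (ham_pair hv hij hs).1

lemma words_three {v : Fin n → (Fin m → F)} (hv : IsHammingMatrix v) {i j : Fin n}
    (hij : i ≠ j) : 0 < (words v 3).card := by
  have hne : v i + v j ≠ 0 := by
    intro h
    have := ham_pair hv hij (a := 1) (b := 1) (by simpa using h)
    simp at this
  obtain ⟨k, c, hk⟩ := (hv.2 _ hne).exists
  have hki : k ≠ i := by
    rintro rfl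
    have := ham_pair hv hij (a := 1 - c) (b := 1) (by rw [sub_smul, ← hk]; simp)
    simp at this
  have hkj : k ≠ j := by
    rintro rfl
    have := ham_pair hv hij (a := 1) (b := 1 - c) (by rw [sub_smul, ← hk]; simp)
    simp at this
  apply Finset.card_pos.2
  let x : Fin n → F := Pi.single i 1 + Pi.single j 1 - Pi.single k c
  refine ⟨x, ?_⟩
  have hx0 : x ≠ 0 := by
    intro h
    have := congrFun h i
    simp [x, hij, hki.symm] at this
  have hxc : checkMap v x = 0 := by
    rw [checkMap_eq]
    simp [x, sub_smul, add_smul, Finset.sum_add_distrib, Pi.single_apply, ite_smul, hk]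
  simp only [words, Finset.mem_filter, Finset.mem_univ, true_and]
  refine ⟨hxc, le_antisymm ?_ (ham_min hv x hxc hx0)⟩
  unfold hammingNorm
  refine le_trans (Finset.card_le_card (t := {i, j, k}) ?_) Finset.card_le_three
  intro l hl
  by_contra hn
  simp only [Finset.mem_insert, Finset.mem_singleton, not_or] at hn
  simp [x, hn.1, hn.2.1, hn.2.2] at hl

lemma ham_span_aux {v : Fin n → (Fin m → F)} (hv : IsHammingMatrix v) (hn : 6 ≤ n)
    {t1 t2 : Fin n} (T : Finset (Fin n)) (hT : T = {t1, t2}) :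
    v t1 ∈ Submodule.span F (Set.range fun i : {i // i ∉ T} => v i.1) := by
  set S := Submodule.span F (Set.range fun i : {i // i ∉ T} => v i.1) with hS
  have hmem : ∀ i, i ≠ t1 → i ≠ t2 → v i ∈ S := by
    intro i h1 h2
    exact Submodule.subset_span ⟨⟨i, by simp [hT, h1, h2]⟩, rfl⟩
  have hcard : 1 < (Finset.univ \ T).card := by
    have h1 := Finset.le_card_sdiff T Finset.univ
    have h2 : T.card ≤ 2 := hT ▸ Finset.card_le_two
    simp only [Finset.card_univ, Fintype.card_fin] at h1
    omega
  obtain ⟨j, hj, l, hl, hjl⟩ := Finset.one_lt_card.1 hcard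
  simp only [hT, Finset.mem_sdiff, Finset.mem_univ, Finset.mem_insert, Finset.mem_singleton,
    true_and, not_or] at hj hl
  have step : ∀ j, j ≠ t1 → j ≠ t2 → v t1 ∈ S ∨ ∃ c : F, c ≠ 0 ∧ v t1 + v j = c • v t2 := by
    intro j h1 h2
    have hne : v t1 + v j ≠ 0 := by
      intro h
      have := ham_pair hv h1.symm (a := 1) (b := 1) (by simpa using h)
      simp at this
    obtain ⟨k, c, hk⟩ := (hv.2 _ hne).exists
    have hc : c ≠ 0 := by
      rintro rfl
      simp [hne] at hk
    by_cases hk2 : k = t2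
    · right
      exact ⟨c, hc, hk2 ▸ hk⟩
    · left
      have hk1 : k ≠ t1 := by
        rintro rfl
        have := ham_pair hv h1.symm (a := 1 - c) (b := 1) (by rw [sub_smul, ← hk]; simp)
        simp at this
      rw [eq_sub_of_add_eq hk]
      exact S.sub_mem (S.smul_mem _ (hmem k hk1 hk2)) (hmem j h1 h2)
  obtain h | ⟨c, hc, hcj⟩ := step j hj.1 hj.2
  · exact h
  obtain h | ⟨d, hd, hdl⟩ := step l hl.1 hl.2
  · exact h
  have hcd : d - c ≠ 0 := by
    intro h
    have : d = c := sub_eq_zero.1 h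
    rw [this, ← hcj] at hdl
    exact ham_ne hv hjl 1 (by simpa using (add_left_cancel hdl).symm)
  have e : (d - c) • v t1 = c • v l - d • v j := by
    have h1 : v j = c • v t2 - v t1 := by rw [← hcj]; simp
    have h2 : v l = d • v t2 - v t1 := by rw [← hdl]; simp
    rw [h1, h2]
    module
  have : (d - c) • v t1 ∈ S := by
    rw [e]
    exact S.sub_mem (S.smul_mem _ (hmem l hl.1 hl.2)) (S.smul_mem _ (hmem j hj.1 hj.2))
  exact (S.smul_mem_iff hcd).1 this

lemma ham_span {v : Fin n → (Fin m → F)} (hv : IsHammingMatrix v) (hn : 6 ≤ n)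
    (t1 t2 : Fin n) :
    Submodule.span F (Set.range fun i : {i // i ∉ ({t1, t2} : Finset (Fin n))} => v i.1) = ⊤ := by
  rw [eq_top_iff]
  intro w _
  by_cases hw : w = 0
  · rw [hw]; exact Submodule.zero_mem _
  obtain ⟨i, c, rfl⟩ := (hv.2 w hw).exists
  apply Submodule.smul_mem
  by_cases h1 : i = t1
  · subst h1
    exact ham_span_aux hv hn _ rfl
  by_cases h2 : i = t2
  · subst h2
    exact ham_span_aux hv hn _ (Finset.pair_comm _ _)
  exact Submodule.subset_span ⟨⟨i, by simp [h1, h2]⟩, rfl⟩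

lemma short_eq (v : Fin n → (Fin m → F)) (T : Finset (Fin n)) :
    shortenedCode (hammingCode v) T =
      LinearMap.ker (Fintype.linearCombination F (fun i : {i // i ∉ T} => v i.1)) := by
  have key : ∀ x : Fin n → F, (∀ i ∈ T, x i = 0) → checkMap v x =
      Fintype.linearCombination F (fun i : {i // i ∉ T} => v i.1) (restrictTo T x) := by
    intro x hx
    rw [checkMap_eq, Fintype.linearCombination_apply]
    rw [← Fintype.sum_subtype_add_sum_subtype (fun i => i ∉ T) (fun i => x i • v i)]
    rw [Finset.sum_eq_zero (s := (Finset.univ : Finset {i // ¬ i ∉ T})), add_zero]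
    · rfl
    · intro i _
      rw [hx i.1 (not_not.1 i.2), zero_smul]
  ext y
  constructor
  · rintro ⟨x, ⟨h1, h0⟩, rfl⟩
    rw [LinearMap.mem_ker, ← key x h0]
    exact h1
  · intro hy
    let x : Fin n → F := fun i => if h : i ∈ T then 0 else y ⟨i, h⟩
    have hx0 : ∀ i ∈ T, x i = 0 := fun i hi => by simp [x, hi]
    have hr : restrictTo T x = y := by
      funext i
      simp [restrictTo, LinearMap.funLeft_apply, x, i.2]
    refine ⟨x, ⟨?_, hx0⟩, hr⟩
    show checkMap v x = 0
    rw [key x hx0, hr]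
    exact hy

lemma choose_id {n k : ℕ} (hk : 2 ≤ k) (hkn : k ≤ n - 2) (hn : 6 ≤ n) :
    Nat.choose n 2 * Nat.choose (n - 2) (k - 2) * ((n - k) * (n - k) - (n - k)) =
      Nat.choose k 2 * Nat.choose (n - 2) k * (n * n - n) := by
  have h1 : n.choose k * k.choose 2 = n.choose 2 * (n - 2).choose (k - 2) :=
    Nat.choose_mul hk
  have h2 : n.choose (k + 2) * (k + 2).choose 2 = n.choose 2 * (n - 2).choose k := by
    simpa using Nat.choose_mul (n := n) (k := k + 2) (s := 2) (by omega)
  have h3 := Nat.choose_succ_right_eq n k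
  have h4 := Nat.choose_succ_right_eq n (k + 1)
  have h5 : n * n - n = 2 * n.choose 2 := by
    rw [Nat.choose_two_right, Nat.mul_div_cancel' (Nat.even_mul_pred_self n).two_dvd,
      Nat.mul_sub, mul_one]
  have h6 : 2 * (k + 2).choose 2 = (k + 2) * (k + 1) := by
    rw [Nat.choose_two_right, Nat.mul_div_cancel' (Nat.even_mul_pred_self _).two_dvd]
    rfl
  have h7 : (n - k) * (n - k) - (n - k) = (n - k) * (n - (k + 1)) := by
    rw [← Nat.sub_sub, Nat.mul_sub (n - k) (n - k) 1, mul_one]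
  rw [h5, ← h1, h7]
  calc _ = k.choose 2 * ((n.choose k * (n - k)) * (n - (k + 1))) := by ring
    _ = k.choose 2 * ((n.choose (k + 1) * (n - (k + 1))) * (k + 1)) := by rw [← h3]; ring
    _ = k.choose 2 * (n.choose (k + 2) * ((k + 2) * (k + 1))) := by rw [← h4]; ring
    _ = k.choose 2 * 2 * (n.choose (k + 2) * (k + 2).choose 2) := by rw [← h6]; ring
    _ = _ := by rw [h2]; ring

end Helpers

/-- The twice-shortened Hamming code `(H_{(q,m)})_{{t₁,t₂}}` is an `[n-2, n-m-2, 3]` code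
with `C(n,2)·C(n-2,k-2)·A_k((H)_{T}) = C(k,2)·C(n-2,k)·A_k(H)` for `0 ≤ k ≤ n-2`
(where `C(n-2, k-2)` is read as `0` when `k < 2`, per the convention `C(a,b) = 0` for
negative `b`). -/
theorem statement8 {F : Type} [Field F] [Fintype F] [DecidableEq F] {m n : ℕ}
    (hq : n * (Fintype.card F - 1) = Fintype.card F ^ m - 1) (hn : 6 ≤ n)
    (v : Fin n → (Fin m → F)) (hv : IsHammingMatrix v) (t1 t2 : Fin n) (h12 : t1 ≠ t2) :
    Nat.card {i : Fin n // i ∉ ({t1, t2} : Finset (Fin n))} = n - 2 ∧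
    Module.finrank F ↥(shortenedCode (hammingCode v) {t1, t2}) = n - m - 2 ∧
    IsMinDist (shortenedCode (hammingCode v) {t1, t2}) 3 ∧
    ∀ k ≤ n - 2,
      Nat.choose n 2 * (if 2 ≤ k then Nat.choose (n - 2) (k - 2) else 0) *
          weightCount (shortenedCode (hammingCode v) {t1, t2}) k
        = Nat.choose k 2 * Nat.choose (n - 2) k * weightCount (hammingCode v) k := by
  have hcard : Nat.card {i : Fin n // i ∉ ({t1, t2} : Finset (Fin n))} = n - 2 := by
    rw [Nat.card_eq_fintype_card, Fintype.card_subtype_compl, Fintype.card_coe,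
      Finset.card_pair h12, Fintype.card_fin]
  refine ⟨hcard, ?_, ⟨?_, ?_⟩, ?_⟩
  · rw [short_eq]
    have h := LinearMap.finrank_range_add_finrank_ker
      (Fintype.linearCombination F
        (fun i : {i // i ∉ ({t1, t2} : Finset (Fin n))} => v i.1))
    rw [Fintype.range_linearCombination, ham_span hv hn, finrank_top, Module.finrank_fin_fun,
      Module.finrank_fintype_fun_eq_card, ← Nat.card_eq_fintype_card, hcard] at h
    omega
  · have hd := double_count hv h12 3
    have hpos : 0 < (words v 3).card * ((n - 3) * (n - 3) - (n - 3)) := by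
      apply Nat.mul_pos (words_three hv h12)
      have : (n - 3) * 3 ≤ (n - 3) * (n - 3) := Nat.mul_le_mul_left _ (by omega)
      omega
    rw [← hd] at hpos
    have hp := Nat.pos_of_mul_pos_left hpos
    obtain ⟨x, hx⟩ := Finset.card_pos.1 hp
    simp only [words, Finset.mem_filter, Finset.mem_univ, true_and] at hx
    have h0 : ∀ i ∈ ({t1, t2} : Finset (Fin n)), x i = 0 := by simpa using hx.2
    have hnorm := norm_restrict {t1, t2} x h0
    rw [hx.1.2] at hnorm
    refine ⟨restrictTo {t1, t2} x, ⟨x, ⟨hx.1.1, h0⟩, rfl⟩, ?_, hnorm⟩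
    apply hammingNorm_pos_iff.1
    omega
  · rintro c ⟨x, ⟨h1, h0⟩, rfl⟩ hc
    rw [norm_restrict _ _ h0]
    apply ham_min hv x h1
    rintro rfl
    simp at hc
  · intro k hk
    rw [weightCount_short, weightCount_ham]
    split_ifs with h2
    · have hd := double_count hv h12 k
      have hc := choose_id h2 hk hn
      have hpos : 0 < n * n - n := by
        have : n * 6 ≤ n * n := Nat.mul_le_mul_left _ hn
        omega
      apply Nat.eq_of_mul_eq_mul_left hpos
      calc _ = n.choose 2 * (n - 2).choose (k - 2) * ((n * n - n) *
            ((words v k).filter fun x => x t1 = 0 ∧ x t2 = 0).card) := by ring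
        _ = (n.choose 2 * (n - 2).choose (k - 2) * ((n - k) * (n - k) - (n - k))) *
            (words v k).card := by rw [hd]; ring
        _ = _ := by rw [hc]; ring
    · rw [Nat.choose_eq_zero_of_lt (show k < 2 by omega)]
      simp
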